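/- arXiv:2503.22043 — 3 statements merged into one kernel-verified Lean document; each statement's English description precedes it below -/
import Mathlib

section
/- For every odd positive integer n and every integer r ≥ 1, the binary word (1 0^r 1)^n, i.e., the concatenation of n copies of the word 1 0^r 1, is not a shuffle square. In particular, for every odd positive integer n, the word (1001)^n is not a shuffle square. -/
/-- `Interleave x y z` means that `z` is an interleaving (shuffle) of the words
`x` and `y`. -/
inductive Interleave {α : Type*} : List α → List α → List α → Prop
  | nil : Interleave [] [] []
  | cons_left (a : α) {xs ys zs : List α} :
      Interleave xs ys zs → Interleave (a :: xs) ys (a :: zs)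
  | cons_right (a : α) {xs ys zs : List α} :
      Interleave xs ys zs → Interleave xs (a :: ys) (a :: zs)

/-- A word is a shuffle square if it is an interleaving of two copies of the same word. -/
def IsShuffleSquare {α : Type*} (w : List α) : Prop :=
  ∃ x : List α, Interleave x x w

/-- The sum, over the zeros of the word, of `(-1) ^ k`, where `k` is the number of ones
before the zero. -/
def signedZeros : List Bool → ℤ
  | [] => 0
  | true :: x => -signedZeros x
  | false :: x => 1 + signedZeros x

theorem Interleave.nil_iff {α : Type*} {x y : List α} :
    Interleave x y [] ↔ x = [] ∧ y = [] := by
  constructor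
  · rintro ⟨⟩
    exact ⟨rfl, rfl⟩
  · rintro ⟨rfl, rfl⟩
    exact .nil

theorem Interleave.cons_iff {α : Type*} {a : α} {x y z : List α} :
    Interleave x y (a :: z) ↔
      (∃ x', x = a :: x' ∧ Interleave x' y z) ∨ ∃ y', y = a :: y' ∧ Interleave x y' z := by
  constructor
  · intro h
    cases h with
    | cons_left _ h => exact .inl ⟨_, rfl, h⟩
    | cons_right _ h => exact .inr ⟨_, rfl, h⟩
  · rintro (⟨x', rfl, h⟩ | ⟨y', rfl, h⟩)
    · exact .cons_left a h
    · exact .cons_right a h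

/-- Removing a leading block of zeros from a shuffle of `x` and `y` lowers
`signedZeros x + signedZeros y` by the length of the block. -/
theorem Interleave.exists_of_replicate_false_append {r : ℕ} {x y z : List Bool}
    (h : Interleave x y (List.replicate r false ++ z)) :
    ∃ x' y', Interleave x' y' z ∧
      signedZeros x + signedZeros y = r + (signedZeros x' + signedZeros y') := by
  induction r generalizing x y with
  | zero => exact ⟨x, y, by simpa using h, by simp⟩
  | succ r ih =>
    rw [List.replicate_succ, List.cons_append, Interleave.cons_iff] at h
    rcases h with ⟨u, rfl, h⟩ | ⟨u, rfl, h⟩ <;>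
    · obtain ⟨x', y', h', e⟩ := ih h
      refine ⟨x', y', h', ?_⟩
      simp only [signedZeros]
      push_cast
      linarith

/-- If `(1 0^r 1)^n` is a shuffle of `x` and `y`, then `signedZeros x - signedZeros y` is `r`
times an integer of the same parity as `n`. -/
theorem Interleave.exists_signedZeros_sub_eq {n r : ℕ} {x y : List Bool}
    (h : Interleave x y
      (List.replicate n (true :: (List.replicate r false ++ [true]))).flatten) :
    ∃ k : ℤ, signedZeros x - signedZeros y = r * (n + 2 * k) := by
  induction n generalizing x y with
  | zero =>
    obtain ⟨rfl, rfl⟩ := Interleave.nil_iff.1 (by simpa using h)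
    exact ⟨0, by simp⟩
  | succ n ih =>
    rw [List.replicate_succ, List.flatten_cons, List.cons_append, List.append_assoc,
      List.singleton_append, Interleave.cons_iff] at h
    rcases h with ⟨u, rfl, h⟩ | ⟨u, rfl, h⟩ <;>
    · obtain ⟨x', y', h', e⟩ := h.exists_of_replicate_false_append
      rcases Interleave.cons_iff.1 h' with ⟨v, rfl, h''⟩ | ⟨v, rfl, h''⟩ <;>
      · obtain ⟨k, hk⟩ := ih h''
        simp only [signedZeros] at e ⊢
        push_cast
        first
          | exact ⟨k, by linear_combination e + hk⟩
          | exact ⟨-n - k, by linear_combination e - hk⟩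
          | exact ⟨-n - k - 1, by linear_combination -e - hk⟩
          | exact ⟨k - 1, by linear_combination -e + hk⟩

theorem not_isShuffleSquare_blocks (n r : ℕ) (hn : Odd n) (hr : 1 ≤ r) :
    ¬ IsShuffleSquare
        (List.replicate n (true :: (List.replicate r false ++ [true]))).flatten := by
  rintro ⟨x, h⟩
  obtain ⟨k, hk⟩ := h.exists_signedZeros_sub_eq
  rw [sub_self, zero_eq_mul] at hk
  obtain ⟨m, rfl⟩ := hn
  omega

/-- For every odd positive integer `n` and every `r ≥ 1`, the word `(1 0^r 1)^n` is not a
shuffle square; in particular `(1001)^n` is not a shuffle square. -/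
theorem statement2 (n r : ℕ) (hn : Odd n) (hn1 : 1 ≤ n) (hr : 1 ≤ r) :
    ¬ IsShuffleSquare
        ((List.replicate n (true :: (List.replicate r false ++ [true]))).flatten) ∧
    ¬ IsShuffleSquare ((List.replicate n [true, false, false, true]).flatten) := by
  exact ⟨not_isShuffleSquare_blocks n r hn hr, not_isShuffleSquare_blocks n 2 hn (by norm_num)⟩
end

section
/- Every even binary word in which every 0-run has length exactly two and every 1-run has length at most two is a shuffle square, unless it is of the form (1001)^n for some odd positive integer n. -/
/-- `RunDecomp w rs` says that `rs` is the run decomposition of `w`: the word `w` is the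
concatenation of blocks `p.1 ^ p.2` for `p ∈ rs`, all blocks are nonempty, and the letters
of consecutive blocks differ (so the blocks are exactly the maximal runs of `w`). -/
def RunDecomp {α : Type*} (w : List α) (rs : List (α × ℕ)) : Prop :=
  w = (rs.map fun p => List.replicate p.2 p.1).flatten ∧
  (∀ p ∈ rs, 0 < p.2) ∧
  List.Chain' (fun p q => p.1 ≠ q.1) rs

/-- `PendingSquare q w` means that `w` is an interleaving of some word `x` with `q ++ x`:
reading `w` completes a shuffle square in which one copy is ahead of the other by `q`. -/
def PendingSquare {α : Type*} (q w : List α) : Prop :=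
  ∃ x : List α, Interleave x (q ++ x) w

namespace PendingSquare

variable {α : Type*} {q w : List α}

lemma nil : PendingSquare ([] : List α) [] := ⟨[], .nil⟩

lemma push (a : α) (h : PendingSquare (q ++ [a]) w) : PendingSquare q (a :: w) := by
  obtain ⟨x, hx⟩ := h
  exact ⟨a :: x, .cons_left a (by simpa using hx)⟩

lemma pop (a : α) (h : PendingSquare q w) : PendingSquare (a :: q) (a :: w) := by
  obtain ⟨x, hx⟩ := h
  exact ⟨x, .cons_right a hx⟩

end PendingSquare

lemma Interleave.append {α : Type*} {x y z x' y' z' : List α} (h : Interleave x y z)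
    (h' : Interleave x' y' z') : Interleave (x ++ x') (y ++ y') (z ++ z') := by
  induction h with
  | nil => exact h'
  | cons_left a _ ih => exact .cons_left a ih
  | cons_right a _ ih => exact .cons_right a ih

lemma IsShuffleSquare.append {α : Type*} {u v : List α} (hu : IsShuffleSquare u)
    (hv : IsShuffleSquare v) : IsShuffleSquare (u ++ v) :=
  let ⟨x, hx⟩ := hu
  let ⟨y, hy⟩ := hv
  ⟨x ++ y, hx.append hy⟩

lemma isShuffleSquare_pair {α : Type*} (a : α) : IsShuffleSquare [a, a] :=
  ⟨[a], .cons_left a (.cons_right a .nil)⟩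

/-- The word `(1001)^n`. -/
abbrev block (n : ℕ) : List Bool := (List.replicate n [true, false, false, true]).flatten

lemma block_succ (n : ℕ) : block (n + 1) = true :: false :: false :: true :: block n := rfl

lemma isShuffleSquare_block_of_even {n : ℕ} (hn : Even n) : IsShuffleSquare (block n) := by
  obtain ⟨m, rfl⟩ := hn
  induction m with
  | zero => exact PendingSquare.nil
  | succ m ih =>
    have h : IsShuffleSquare (block 2) := by
      show PendingSquare [] _
      exact .push _ <| .push _ <| .push _ <| .push _ <| .pop _ <| .pop _ <| .pop _ <| .pop _ .nil
    rw [show m + 1 + (m + 1) = m + m + 1 + 1 by omega]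
    exact h.append ih

lemma pendingSquare_zero_zero_one (m : ℕ) :
    PendingSquare [false, false, true] (false :: false :: true :: block (2 * m)) := by
  induction m with
  | zero => exact .pop _ <| .pop _ <| .pop _ .nil
  | succ m ih =>
    rw [show 2 * (m + 1) = 2 * m + 1 + 1 by ring, block_succ, block_succ]
    exact .pop _ <| .pop _ <| .pop _ <| .push _ <| .push _ <| .push _ <| .pop _ <| .push _ ih

lemma pendingSquare_one_zero_zero {v : List Bool} (m : ℕ)
    (h : PendingSquare [true, false, false] (true :: v)) :
    PendingSquare [true, false, false] (true :: (block (2 * m) ++ v)) := by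
  induction m with
  | zero => exact h
  | succ m ih =>
    rw [show 2 * (m + 1) = 2 * m + 1 + 1 by ring, block_succ, block_succ]
    exact .pop _ <| .push _ <| .pop _ <| .pop _ <| .pop _ <| .push _ <| .push _ <| .push _ ih

lemma isShuffleSquare_block_append {v : List Bool} {n : ℕ} (hn : Odd n)
    (h : PendingSquare [true, false, false] (true :: v)) : IsShuffleSquare (block n ++ v) := by
  obtain ⟨m, rfl⟩ := hn
  rw [block_succ]
  show PendingSquare [] _
  exact .push _ <| .push _ <| .push _ <| pendingSquare_one_zero_zero m h

lemma isShuffleSquare_zeros_block {n : ℕ} (hn : Odd n) :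
    IsShuffleSquare (false :: false :: block n) := by
  obtain ⟨m, rfl⟩ := hn
  rw [block_succ]
  show PendingSquare [] _
  exact .push _ <| .push _ <| .push _ <| pendingSquare_zero_zero_one m

lemma isShuffleSquare_block_zeros (n : ℕ) : IsShuffleSquare (block n ++ [false, false]) := by
  rcases Nat.even_or_odd n with hn | hn
  · exact (isShuffleSquare_block_of_even hn).append (isShuffleSquare_pair false)
  · exact isShuffleSquare_block_append hn <| .pop _ <| .pop _ <| .pop _ .nil

lemma isShuffleSquare_block_zeros_block (n : ℕ) {k : ℕ} (hk : Odd k) :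
    IsShuffleSquare (block n ++ false :: false :: block k) := by
  rcases Nat.even_or_odd n with hn | hn
  · exact (isShuffleSquare_block_of_even hn).append (isShuffleSquare_zeros_block hk)
  · obtain ⟨m, rfl⟩ := hk
    rw [block_succ]
    exact isShuffleSquare_block_append hn <|
      .pop _ <| .pop _ <| .push _ <| .push _ <| pendingSquare_zero_zero_one m

/-- `RunWord b w` means that `w` is empty or begins with a `b`-run, that every `0`-run of `w`
has length two, and that every `1`-run of `w` has length one or two. -/
inductive RunWord : Bool → List Bool → Prop
  | nil (b : Bool) : RunWord b []
  | zeros {w : List Bool} : RunWord true w → RunWord false (false :: false :: w)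
  | one {w : List Bool} : RunWord false w → RunWord true (true :: w)
  | ones {w : List Bool} : RunWord false w → RunWord true (true :: true :: w)

lemma runWord_of_runs {rs : List (Bool × ℕ)} (hpos : ∀ p ∈ rs, 0 < p.2)
    (hchain : rs.IsChain fun p q => p.1 ≠ q.1)
    (hruns : ∀ p ∈ rs, (p.1 = false → p.2 = 2) ∧ (p.1 = true → p.2 ≤ 2)) (b : Bool)
    (hb : ∀ p ∈ rs.head?, p.1 = b) :
    RunWord b (rs.map fun p => List.replicate p.2 p.1).flatten := by
  induction rs generalizing b with
  | nil => exact .nil b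
  | cons p rs ih =>
    obtain ⟨c, k⟩ := p
    obtain rfl : c = b := by simpa using hb
    rw [List.isChain_cons] at hchain
    simp only [List.forall_mem_cons] at hpos hruns
    have hrest := ih hpos.2 hchain.2 hruns.2 (!c) fun q hq => by
      have := hchain.1 q hq
      revert this
      cases c <;> cases q.1 <;> simp
    cases c with
    | false =>
      obtain rfl : k = 2 := hruns.1.1 rfl
      exact .zeros hrest
    | true =>
      have hk : k ≤ 2 := hruns.1.2 rfl
      have hk' : 0 < k := hpos.1
      interval_cases k
      · exact .one hrest
      · exact .ones hrest

lemma RunWord.exists_eq_block_append {b : Bool} {u : List Bool} (h : RunWord b u)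
    (hb : b = false) (hodd : Odd (u.count true)) :
    ∃ n v, true :: u = block (n + 1) ++ v ∧ RunWord false v ∧ Even (v.count true) := by
  induction hl : u.length using Nat.strong_induction_on generalizing u with
  | _ l ih =>
    subst hb
    cases h with
    | nil => simp at hodd
    | zeros h =>
      cases h with
      | nil => simp at hodd
      | one h => exact ⟨0, _, rfl, h, by simpa [Nat.odd_add_one] using hodd⟩
      | @ones w h =>
        obtain ⟨n, v, he, hv⟩ := ih w.length (by simp [← hl]; omega) h
          (by simpa [Nat.odd_add_one] using hodd) rfl
        exact ⟨n + 1, v, by rw [block_succ, he]; rfl, hv⟩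

lemma RunWord.isShuffleSquare_or_eq_block {b : Bool} {w : List Bool} (h : RunWord b w)
    (heven : Even (w.count true)) :
    IsShuffleSquare w ∨ ∃ n, Odd n ∧ w = block n := by
  induction hl : w.length using Nat.strong_induction_on generalizing b w with
  | _ l ih =>
    cases h with
    | nil => exact .inl PendingSquare.nil
    | @zeros u h =>
      obtain hu | ⟨n, hn, rfl⟩ := ih u.length (by simp [← hl]) h (by simpa using heven) rfl
      · exact .inl ((isShuffleSquare_pair false).append hu)
      · exact .inl (isShuffleSquare_zeros_block hn)
    | @ones u h =>
      obtain hu | ⟨n, hn, rfl⟩ := ih u.length (by simp [← hl]) h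
        (by simpa [Nat.even_add_one] using heven) rfl
      · exact .inl ((isShuffleSquare_pair true).append hu)
      · obtain ⟨m, rfl⟩ := hn
        rw [block_succ] at h
        cases h
    | @one u h =>
      obtain ⟨n, v, he, hv, hve⟩ := h.exists_eq_block_append rfl
        (by simpa [Nat.even_add_one] using heven)
      rw [he] at hl ⊢
      cases hv with
      | nil =>
        rw [List.append_nil]
        rcases Nat.even_or_odd (n + 1) with hn | hn
        · exact .inl (isShuffleSquare_block_of_even hn)
        · exact .inr ⟨_, hn, rfl⟩
      | @zeros v hv =>
        obtain hs | ⟨k, hk, rfl⟩ := ih v.length (by simp [← hl]; omega) hv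
          (by simpa using hve) rfl
        · left
          simpa using (isShuffleSquare_block_zeros (n + 1)).append hs
        · exact .inl (isShuffleSquare_block_zeros_block _ hk)

/-- Every even binary word whose `0`-runs all have length exactly two and whose `1`-runs
all have length at most two is a shuffle square, unless it is `(1001)^n` for some odd `n`. -/
theorem statement5 (w : List Bool) (rs : List (Bool × ℕ)) (hrd : RunDecomp w rs)
    (heven1 : Even (w.count true)) (heven0 : Even (w.count false))
    (hruns : ∀ p ∈ rs, (p.1 = false → p.2 = 2) ∧ (p.1 = true → p.2 ≤ 2))
    (hnot : ¬ ∃ n : ℕ, Odd n ∧ w = (List.replicate n [true, false, false, true]).flatten) :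
    IsShuffleSquare w := by
  obtain ⟨rfl, hpos, hchain⟩ := hrd
  have hw : ∃ b, RunWord b (rs.map fun p => List.replicate p.2 p.1).flatten := by
    cases rs with
    | nil => exact ⟨true, .nil true⟩
    | cons p rs => exact ⟨p.1, runWord_of_runs hpos hchain hruns p.1 (by simp)⟩
  obtain ⟨b, hb⟩ := hw
  exact (hb.isShuffleSquare_or_eq_block heven1).resolve_right hnot
end

section
/- An even binary word with exactly three runs is a shuffle square if and only if all three of its runs have even length. Equivalently: for positive integers a, b, c with a + c and b both even, the word 1^a 0^b 1^c is a shuffle square if and only if a, b, c are all even. -/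
namespace Interleave

variable {α : Type*}

theorem append_s13 {x₁ y₁ z₁ x₂ y₂ z₂ : List α} (h₁ : Interleave x₁ y₁ z₁)
    (h₂ : Interleave x₂ y₂ z₂) : Interleave (x₁ ++ x₂) (y₁ ++ y₂) (z₁ ++ z₂) := by
  induction h₁ with
  | nil => exact h₂
  | cons_left a _ ih => exact ih.cons_left a
  | cons_right a _ ih => exact ih.cons_right a

theorem exists_of_append {x y z₂ : List α} (z₁ : List α) (h : Interleave x y (z₁ ++ z₂)) :
    ∃ x₁ x₂ y₁ y₂, x = x₁ ++ x₂ ∧ y = y₁ ++ y₂ ∧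
      Interleave x₁ y₁ z₁ ∧ Interleave x₂ y₂ z₂ := by
  induction z₁ generalizing x y with
  | nil => exact ⟨[], x, [], y, rfl, rfl, .nil, h⟩
  | cons a z ih =>
    rw [List.cons_append] at h
    cases h with
    | cons_left _ h =>
      obtain ⟨x₁, x₂, y₁, y₂, rfl, rfl, h₁, h₂⟩ := ih h
      exact ⟨a :: x₁, x₂, y₁, y₂, rfl, rfl, h₁.cons_left a, h₂⟩
    | cons_right _ h =>
      obtain ⟨x₁, x₂, y₁, y₂, rfl, rfl, h₁, h₂⟩ := ih h
      exact ⟨x₁, x₂, a :: y₁, y₂, rfl, rfl, h₁.cons_right a, h₂⟩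

theorem exists_of_replicate {a : α} {n : ℕ} {x y : List α}
    (h : Interleave x y (List.replicate n a)) :
    ∃ p q, x = List.replicate p a ∧ y = List.replicate q a ∧ p + q = n := by
  induction n generalizing x y with
  | zero =>
    cases h
    exact ⟨0, 0, rfl, rfl, rfl⟩
  | succ n ih =>
    rw [List.replicate_succ] at h
    cases h with
    | cons_left _ h =>
      obtain ⟨p, q, rfl, rfl, rfl⟩ := ih h
      exact ⟨p + 1, q, rfl, rfl, by omega⟩
    | cons_right _ h =>
      obtain ⟨p, q, rfl, rfl, rfl⟩ := ih h
      exact ⟨p, q + 1, rfl, rfl, by omega⟩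

theorem replicate (a : α) (n : ℕ) :
    Interleave (List.replicate n a) (List.replicate n a) (List.replicate (n + n) a) := by
  induction n with
  | zero => exact .nil
  | succ n ih =>
    rw [show n + 1 + (n + 1) = n + n + 1 + 1 by omega]
    exact (ih.cons_right a).cons_left a

end Interleave

theorem List.replicate_append_cons_inj_left {α : Type*} {a b : α} (hab : a ≠ b) {p q : ℕ}
    {l m : List α} (h : replicate p a ++ b :: l = replicate q a ++ b :: m) : p = q := by
  induction p generalizing q with
  | zero => cases q <;> simp_all [replicate_succ, hab.symm]
  | succ p ih =>
    cases q with
    | zero => simp_all [replicate_succ]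
    | succ q => rw [ih (by simpa [replicate_succ] using h)]

/-- For positive integers `a, b, c` with `a + c` and `b` both even, the word
`1^a 0^b 1^c` is a shuffle square if and only if `a`, `b`, `c` are all even. -/
theorem statement13 (a b c : ℕ) (ha : 0 < a) (hb : 0 < b) (hc : 0 < c)
    (hac : Even (a + c)) (hbe : Even b) :
    IsShuffleSquare
        (List.replicate a true ++ List.replicate b false ++ List.replicate c true) ↔
      Even a ∧ Even b ∧ Even c := by
  constructor
  · rintro ⟨x, h⟩
    obtain ⟨u, x₃, v, y₃, hx, hy, h, h₃⟩ := h.exists_of_append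
    obtain ⟨x₁, x₂, y₁, y₂, rfl, rfl, h₁, h₂⟩ := h.exists_of_append
    obtain ⟨p, p', rfl, rfl, hp⟩ := h₁.exists_of_replicate
    obtain ⟨r, r', rfl, rfl, hr⟩ := h₂.exists_of_replicate
    obtain ⟨s, s', rfl, rfl, hs⟩ := h₃.exists_of_replicate
    rw [hx] at hy
    have hrr : r = r' := by
      simpa [List.count_replicate] using congrArg (List.count false) hy
    obtain ⟨k, rfl⟩ : ∃ k, r = k + 1 := ⟨r - 1, by omega⟩
    subst hrr
    have hpp : p = p' := by
      simp only [List.append_assoc, List.replicate_succ, List.cons_append] at hy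
      exact List.replicate_append_cons_inj_left (by decide) hy
    have hae : Even a := ⟨p, by omega⟩
    exact ⟨hae, hbe, (Nat.even_add.mp hac).mp hae⟩
  · rintro ⟨⟨p, rfl⟩, ⟨q, rfl⟩, ⟨r, rfl⟩⟩
    exact ⟨_, ((Interleave.replicate true p).append_s13 (Interleave.replicate false q)).append_s13
      (Interleave.replicate true r)⟩
end
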